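/- arXiv:0903.1746 — 8 statements merged into one kernel-verified Lean document; each statement's English description precedes it below -/
import Mathlib

section
/- Let I be a partially ordered set, let i, j ∈ I with i < j, and let A be a maximal chain of I with i ∈ A. Then there exists a maximal chain B of I such that j ∈ B and B ∩ {x ∈ I : x ≤ i} = A ∩ {x ∈ I : x ≤ i}. -/
universe u

/-- in a poset, if `i < j` and `A` is a maximal chain containing `i`, then there
is a maximal chain `B` containing `j` with `B ∩ {x | x ≤ i} = A ∩ {x | x ≤ i}`. -/
theorem exists_maxChain_above (I : Type u) [PartialOrder I] (i j : I) (hij : i < j)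
    (A : Set I) (hA : IsMaxChain (· ≤ ·) A) (hiA : i ∈ A) :
    ∃ B : Set I, IsMaxChain (· ≤ ·) B ∧ j ∈ B ∧
      B ∩ {x | x ≤ i} = A ∩ {x | x ≤ i} := by
  have hC : IsChain (· ≤ ·) (insert j (A ∩ {x | x ≤ i})) :=
    (hA.isChain.mono Set.inter_subset_left).insert
      fun b hb _ => Or.inr (le_trans hb.2 hij.le)
  obtain ⟨B, hB, hCB⟩ := hC.exists_maxChain
  refine ⟨B, hB, hCB (Set.mem_insert _ _), Set.Subset.antisymm ?_ ?_⟩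
  · rintro b ⟨hbB, hbi⟩
    refine ⟨?_, hbi⟩
    refine (Flag.mem_iff_forall_le_or_ge (s := Flag.ofIsMaxChain A hA)).2 fun a ha => ?_
    rcases hA.isChain.total ha hiA with hai | hia
    · exact hB.isChain.total hbB (hCB (Set.mem_insert_of_mem _ ⟨ha, hai⟩))
    · exact Or.inl (le_trans hbi hia)
  · exact fun a ha => ⟨hCB (Set.mem_insert_of_mem _ ha), ha.2⟩
end

section
/- Let R be a ring whose right socle L = Soc(R_R) is projective as a right R-module and essential as a right ideal. Assume that R has a (unital) subring S such that R = S + L (every element of R is the sum of an element of S and an element of L) and such that R is flat as a left S-module. If S is right hereditary, then R is right hereditary. -/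
open MulOpposite

universe u

/-- The right socle of a ring `R`, viewed as the left ideal of `Rᵐᵒᵖ` which is the sum of all
simple right ideals of `R` (the supremum of the atoms of the lattice of right ideals). -/
def rightSocle (R : Type u) [Ring R] : Ideal Rᵐᵒᵖ :=
  sSup {I : Ideal Rᵐᵒᵖ | IsAtom I}

/-- A submodule contained in the right socle has a complement inside the right socle. -/
theorem exists_disjoint_sup_eq_rightSocle {R : Type u} [Ring R] {N : Ideal Rᵐᵒᵖ}
    (hN : N ≤ rightSocle R) : ∃ K : Ideal Rᵐᵒᵖ, Disjoint N K ∧ N ⊔ K = rightSocle R := by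
  obtain ⟨s, -, hdisj, hsup, -⟩ := exists_sSupIndep_disjoint_sSup_atoms N (rightSocle R) hN <|
    le_antisymm (sSup_le fun _ h ↦ h.1) (sSup_le fun a ha ↦ le_sSup ⟨le_sSup ha, ha⟩)
  exact ⟨sSup s, hdisj, hsup⟩

/-- The internal direct sum of two disjoint submodules is projective if and only if both
summands are. -/
theorem Submodule.projective_sup_iff {A M : Type*} [Ring A] [AddCommGroup M] [Module A M]
    {N K : Submodule A M} (h : Disjoint N K) :
    Module.Projective A ↥(N ⊔ K) ↔ Module.Projective A N ∧ Module.Projective A K := by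
  have hinj : Function.Injective (N.subtype.coprod K.subtype) := by
    rw [← LinearMap.ker_eq_bot, LinearMap.ker_coprod_of_disjoint_range _ _ (by simpa using h),
      ker_subtype, ker_subtype, prod_bot]
  let e : (N × K) ≃ₗ[A] ↥(N ⊔ K) :=
    (LinearEquiv.ofInjective _ hinj).trans (LinearEquiv.ofEq _ _ (by simp [LinearMap.range_coprod]))
  refine ⟨fun _ ↦ ?_, fun ⟨_, _⟩ ↦ Module.Projective.of_equiv e⟩
  have := Module.Projective.of_equiv e.symm
  exact ⟨Module.Projective.of_split (LinearMap.inl A N K) (LinearMap.fst A N K) (by ext; rfl),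
    Module.Projective.of_split (LinearMap.inr A N K) (LinearMap.snd A N K) (by ext; rfl)⟩

/-- The range of a linear map `f` on a projective module is projective if `f` is fixed by
precomposition with an endomorphism that vanishes on the kernel of `f`. -/
theorem LinearMap.projective_range_of_comp_eq {A M P : Type*} [Ring A] [AddCommGroup M] [Module A M]
    [AddCommGroup P] [Module A P] [Module.Projective A P] (f : P →ₗ[A] M) (g : P →ₗ[A] P)
    (hker : ker f ≤ ker g) (hfg : f ∘ₗ g = f) : Module.Projective A (range f) := by
  refine Module.Projective.of_split
    ((ker f).liftQ g hker ∘ₗ f.quotKerEquivRange.symm.toLinearMap) f.rangeRestrict ?_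
  ext x
  obtain ⟨y, rfl⟩ := f.quotKerEquivRange.surjective x
  obtain ⟨p, rfl⟩ := Submodule.mkQ_surjective _ y
  simpa using LinearMap.congr_fun hfg p

/-- A finitely supported linear combination as a sum over an enumeration of the support. -/
theorem Finsupp.linearCombination_eq_sum_equivFin {A ι M : Type*} [Semiring A] [AddCommMonoid M]
    [Module A M] (v : ι → M) (p : ι →₀ A) :
    linearCombination A v p =
      ∑ i, p (p.support.equivFin.symm i) • v (p.support.equivFin.symm i) := by
  rw [linearCombination_apply, Finsupp.sum, ← Finset.sum_coe_sort,
    ← p.support.equivFin.symm.sum_comp]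

/-- Extending a projective left ideal along a ring homomorphism that satisfies the equational
criterion for flatness on the right yields a projective left ideal. -/
theorem Ideal.projective_map_of_equational_criterion {A B : Type*} [Ring A] [Ring B] (φ : A →+* B)
    (hflat : ∀ (n : ℕ) (a : Fin n → A) (b : Fin n → B), ∑ i, b i * φ (a i) = 0 →
      ∃ (k : ℕ) (t : Fin n → Fin k → A) (b' : Fin k → B),
        (∀ j, ∑ i, t i j * a i = 0) ∧ ∀ i, b i = ∑ j, b' j * φ (t i j))
    (J : Ideal A) [Module.Projective A J] : Module.Projective B (J.map φ) := by
  obtain ⟨s, hs⟩ := (Module.projective_def' (R := A) (P := J)).1 inferInstance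
  let c : (J →₀ A) →+ (J →₀ B) := Finsupp.mapRange.addMonoidHom φ.toAddMonoidHom
  have hc (a : A) (p : J →₀ A) : c (a • p) = φ a • c p := by
    ext; simp [c]
  let f : (J →₀ B) →ₗ[B] B := Finsupp.linearCombination B fun x : J ↦ φ x
  let g : (J →₀ B) →ₗ[B] (J →₀ B) := Finsupp.linearCombination B fun x : J ↦ c (s x)
  have hfc (p : J →₀ A) : f (c p) = φ (Finsupp.linearCombination A id p : J) := by
    induction p using Finsupp.induction_linear with
    | zero => simp
    | add p q hp hq => simp [hp, hq]
    | single x a => simp [f, c]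
  have hrange : LinearMap.range f = J.map φ := by
    rw [Finsupp.range_linearCombination, Ideal.map, Ideal.span]
    congr 1
    ext; simp
  rw [← hrange]
  refine f.projective_range_of_comp_eq g (fun p hp ↦ ?_) ?_
  · let e := p.support.equivFin.symm
    rw [LinearMap.mem_ker, Finsupp.linearCombination_eq_sum_equivFin] at hp
    obtain ⟨k, t, b, ht, hb⟩ := hflat _ (fun i ↦ (e i : J)) (fun i ↦ p (e i)) hp
    have ht' (j) : ∑ i, t i j • (e i : J) = 0 := by
      ext; simpa using ht j
    have key (i) : p (e i) • c (s (e i)) = ∑ j, b j • c (s (t i j • (e i : J))) := by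
      simp only [hb i, Finset.sum_smul, mul_smul, map_smul, hc]
    rw [LinearMap.mem_ker, Finsupp.linearCombination_eq_sum_equivFin]
    refine (Finset.sum_congr rfl fun i _ ↦ key i).trans ?_
    rw [Finset.sum_comm]
    simp only [← Finset.smul_sum, ← map_sum, ht', map_zero, smul_zero, Finset.sum_const_zero]
  · ext x
    have := LinearMap.congr_fun hs x
    simp only [LinearMap.comp_apply, LinearMap.id_apply] at this
    simp [g, hfc, this, f]

/-- Let `R` be a ring whose right socle `L` is projective as a right `R`-module and
essential as a right ideal.  Assume `R` has a subring `S` with `R = S + L` and such that `R` is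
flat as a left `S`-module (expressed by the equational criterion for flatness of the left
`S`-module `R`, where `S` acts by left multiplication).  If `S` is right hereditary then `R` is
right hereditary. -/
theorem right_hereditary_of_subring_hereditary
    {R : Type u} [Ring R]
    (hproj : Module.Projective Rᵐᵒᵖ ↥(rightSocle R))
    (hess : ∀ K : Ideal Rᵐᵒᵖ, K ≠ ⊥ → rightSocle R ⊓ K ≠ ⊥)
    (S : Subring R)
    (hsum : ∀ r : R, ∃ s ∈ S, ∃ l : R, op l ∈ rightSocle R ∧ r = s + l)
    (hflat : ∀ (n : ℕ) (s : Fin n → S) (m : Fin n → R),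
      (∑ i, (s i : R) * m i) = 0 →
      ∃ (k : ℕ) (t : Fin n → Fin k → S) (m' : Fin k → R),
        (∀ j, ∑ i, (s i : R) * (t i j : R) = 0) ∧ (∀ i, m i = ∑ j, (t i j : R) * m' j))
    (hS : ∀ J : Ideal Sᵐᵒᵖ, Module.Projective Sᵐᵒᵖ ↥J) :
    ∀ I : Ideal Rᵐᵒᵖ, Module.Projective Rᵐᵒᵖ ↥I := by
  intro I
  let φ : Sᵐᵒᵖ →+* Rᵐᵒᵖ := S.subtype.op
  obtain ⟨K, hdK, hK⟩ := exists_disjoint_sup_eq_rightSocle (inf_le_right (a := I))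
  have hKL : K ≤ rightSocle R := hK ▸ le_sup_right
  have hIK : Disjoint I K := by
    rw [disjoint_iff_inf_le] at hdK ⊢
    exact fun x hx ↦ hdK ⟨⟨hx.1, hKL hx.2⟩, hx.2⟩
  have hLI : rightSocle R ≤ I ⊔ K := hK ▸ sup_le_sup_right inf_le_left K
  refine ((Submodule.projective_sup_iff hIK).1 ?_).1
  generalize I ⊔ K = I' at hLI
  let J : Ideal Sᵐᵒᵖ := I'.comap φ
  have hJI : J.map φ ≤ I' := Ideal.map_le_iff_le_comap.2 le_rfl
  have hJL : J.map φ ⊔ rightSocle R = I' := by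
    refine le_antisymm (sup_le hJI hLI) fun x hx ↦ ?_
    obtain ⟨s, hs, l, hl, hx'⟩ := hsum x.unop
    have hx'' : x = φ (op ⟨s, hs⟩) + op l := unop_injective hx'
    rw [hx'']
    refine Submodule.add_mem_sup (Ideal.mem_map_of_mem _ ?_) hl
    rw [Ideal.mem_comap, ← add_sub_cancel_right (φ _) (op l), ← hx'']
    exact I'.sub_mem hx (hLI hl)
  obtain ⟨K', hdK', hK'⟩ := exists_disjoint_sup_eq_rightSocle (inf_le_right (a := J.map φ))
  have hKL' : K' ≤ rightSocle R := hK' ▸ le_sup_right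
  have hJK : Disjoint (J.map φ) K' := by
    rw [disjoint_iff_inf_le] at hdK' ⊢
    exact fun x hx ↦ hdK' ⟨⟨hx.1, hKL' hx.2⟩, hx.2⟩
  have hsup : J.map φ ⊔ K' = I' := by
    rw [← hJL, ← hK', ← sup_assoc, sup_inf_self]
  rw [← hsup, Submodule.projective_sup_iff hJK]
  refine ⟨?_, ((Submodule.projective_sup_iff hdK').1 (by rwa [hK'])).2⟩
  have := hS J
  refine Ideal.projective_map_of_equational_criterion φ (fun n a b h ↦ ?_) J
  obtain ⟨k, t, m, ht, hm⟩ := hflat n (fun i ↦ (a i).unop) (fun i ↦ (b i).unop) (by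
    simpa [φ] using congrArg unop h)
  refine ⟨k, fun i j ↦ op (t i j), fun j ↦ op (m j), fun j ↦ unop_injective (Subtype.ext ?_),
    fun i ↦ unop_injective ?_⟩
  · simpa using ht j
  · simpa [φ] using hm i
end

section
/- Let R be a right semiartinian ring of Loewy length at most 2, i.e. such that the quotient R/Soc(R_R) is a semisimple ring, and assume that the right socle Soc(R_R) is projective as a right R-module. Then R is right hereditary. -/
open MulOpposite

universe u

/-- A ring is right semiartinian if every nonzero right module contains a simple submodule.
Right modules are formalized as modules over the opposite ring. -/
def RightSemiartinian (R : Type u) [Ring R] : Prop :=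
  ∀ (M : Type u) [AddCommGroup M] [Module Rᵐᵒᵖ M], Nontrivial M →
    ∃ N : Submodule Rᵐᵒᵖ M, IsSimpleModule Rᵐᵒᵖ ↥N

/-- An extension of a projective module by a projective module is projective. -/
theorem Module.Projective.of_surjective_of_ker {S M P : Type*} [Ring S] [AddCommGroup M]
    [Module S M] [AddCommGroup P] [Module S P] [Module.Projective S P] (f : M →ₗ[S] P)
    (hf : Function.Surjective f) [Module.Projective S ↥(LinearMap.ker f)] :
    Module.Projective S M := by
  obtain ⟨s, hs⟩ := Module.projective_lifting_property f LinearMap.id hf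
  have hs' (x : P) : f (s x) = x := LinearMap.congr_fun hs x
  let r : M →ₗ[S] ↥(LinearMap.ker f) :=
    (LinearMap.id - s ∘ₗ f).codRestrict _ fun x => by simp [hs']
  refine Module.Projective.of_split (r.prod f) ((LinearMap.ker f).subtype.coprod s) ?_
  ext x
  simp [r]

/-- A submodule is projective if its sum and its intersection with some other submodule are. -/
theorem Submodule.projective_of_sup_of_inf {S M : Type*} [Ring S] [AddCommGroup M] [Module S M]
    (N N' : Submodule S M) [Module.Projective S ↥(N ⊔ N')] [Module.Projective S ↥(N ⊓ N')] :
    Module.Projective S ↥N := by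
  let f : ↥N × ↥N' →ₗ[S] ↥(N ⊔ N') :=
    (inclusion le_sup_left).coprod (inclusion le_sup_right)
  have hf (x : ↥N × ↥N') : (f x : M) = x.1 + x.2 := rfl
  have hsurj : Function.Surjective f := by
    rintro ⟨z, hz⟩
    obtain ⟨x, hx, y, hy, rfl⟩ := Submodule.mem_sup.1 hz
    exact ⟨(⟨x, hx⟩, ⟨y, hy⟩), rfl⟩
  let i : ↥(N ⊓ N') →ₗ[S] ↥(LinearMap.ker f) :=
    ((inclusion inf_le_left).prod (-inclusion inf_le_right)).codRestrict _ fun x => by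
      rw [LinearMap.mem_ker, Subtype.ext_iff, hf]
      simp
  have hi : Function.Bijective i := by
    refine ⟨fun x y h => ?_, ?_⟩
    · exact Subtype.ext (congrArg (fun w : ↥(LinearMap.ker f) => (w.1.1 : M)) h)
    · rintro ⟨⟨⟨x, hx⟩, ⟨y, hy⟩⟩, h⟩
      have hxy : x + y = 0 := congrArg Subtype.val (LinearMap.mem_ker.1 h)
      obtain rfl : y = -x := (neg_eq_of_add_eq_zero_right hxy).symm
      exact ⟨⟨x, hx, neg_mem_iff.1 hy⟩, rfl⟩
  have := Module.Projective.of_equiv (LinearEquiv.ofBijective i hi)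
  have := Module.Projective.of_surjective_of_ker f hsurj
  exact Module.Projective.of_split (LinearMap.inl S ↥N ↥N') (LinearMap.fst S ↥N ↥N')
    (LinearMap.fst_comp_inl ..)

/-- A submodule containing `K` has a complement relative to `K` when `M ⧸ K` is semisimple. -/
theorem Submodule.exists_sup_eq_top_inf_eq {S M : Type*} [Ring S] [AddCommGroup M] [Module S M]
    {K E : Submodule S M} [IsSemisimpleModule S (M ⧸ K)] (hE : K ≤ E) :
    ∃ E' : Submodule S M, E ⊔ E' = ⊤ ∧ E ⊓ E' = K := by
  obtain ⟨C, hC⟩ := ComplementedLattice.exists_isCompl (E.map K.mkQ)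
  have hE' : (E.map K.mkQ).comap K.mkQ = E := by simpa using hE
  refine ⟨C.comap K.mkQ, ?_, ?_⟩
  · have h : (E ⊔ C.comap K.mkQ).map K.mkQ = ⊤ := by
      rw [map_sup, map_comap_eq_of_surjective K.mkQ_surjective, hC.sup_eq_top]
    have h' := congrArg (fun L => comap K.mkQ L) h
    rwa [comap_map_mkQ, sup_eq_right.2 (hE.trans le_sup_left), comap_top] at h'
  · nth_rewrite 1 [← hE']
    rw [← comap_inf, hC.inf_eq_bot, comap_bot, ker_mkQ]

/-- In the presence of a semisimple submodule `K`, any `N` is a direct summand of `N ⊔ K`. -/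
theorem Submodule.exists_sup_eq_sup_disjoint {S M : Type*} [Ring S] [AddCommGroup M] [Module S M]
    (N K : Submodule S M) [IsSemisimpleModule S ↥K] :
    ∃ C : Submodule S M, N ⊔ C = N ⊔ K ∧ N ⊓ C = ⊥ := by
  obtain ⟨D, hD⟩ := ComplementedLattice.exists_isCompl (N.comap K.subtype)
  have hDK : D.map K.subtype ≤ K := map_subtype_le K D
  have hsup := congrArg (fun L => map K.subtype L) hD.sup_eq_top
  have hinf := congrArg (fun L => map K.subtype L) hD.inf_eq_bot
  rw [map_sup, map_comap_subtype, map_subtype_top] at hsup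
  rw [map_inf _ K.injective_subtype, map_comap_subtype, map_bot] at hinf
  refine ⟨D.map K.subtype, ?_, ?_⟩
  · conv_rhs => rw [← hsup, ← sup_assoc, sup_eq_left.2 (inf_le_right : K ⊓ N ≤ N)]
  · rw [← hinf, inf_comm K N, inf_assoc, inf_eq_right.2 hDK]

instance isSemisimpleModule_rightSocle (R : Type u) [Ring R] :
    IsSemisimpleModule Rᵐᵒᵖ ↥(rightSocle R) := by
  rw [rightSocle, sSup_eq_iSup]
  exact isSemisimpleModule_biSup_of_isSemisimpleModule_submodule fun I hI => by
    have := isSimpleModule_iff_isAtom.2 hI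
    infer_instance

/-- a right semiartinian ring of Loewy length at most 2 (i.e. `R/Soc(R_R)` is a
semisimple ring, expressed as semisimplicity of the right `R`-module `R/Soc(R_R)`) whose right
socle is projective as a right `R`-module is right hereditary. -/
theorem right_hereditary_of_loewyLength_le_two
    {R : Type u} [Ring R]
    (hsa : RightSemiartinian R)
    (hss : IsSemisimpleModule Rᵐᵒᵖ (Rᵐᵒᵖ ⧸ rightSocle R))
    (hproj : Module.Projective Rᵐᵒᵖ ↥(rightSocle R)) :
    ∀ I : Ideal Rᵐᵒᵖ, Module.Projective Rᵐᵒᵖ ↥I := by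
  intro I
  obtain ⟨E', hsup, hinf⟩ :=
    Submodule.exists_sup_eq_top_inf_eq (le_sup_right : rightSocle R ≤ I ⊔ rightSocle R)
  have : Module.Projective Rᵐᵒᵖ ↥(I ⊔ rightSocle R ⊔ E') := by
    rw [hsup]
    exact Module.Projective.of_equiv Submodule.topEquiv.symm
  have : Module.Projective Rᵐᵒᵖ ↥((I ⊔ rightSocle R) ⊓ E') := by rwa [hinf]
  have hE := Submodule.projective_of_sup_of_inf (I ⊔ rightSocle R) E'
  obtain ⟨C, hsup', hinf'⟩ := I.exists_sup_eq_sup_disjoint (rightSocle R)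
  have : Module.Projective Rᵐᵒᵖ ↥(I ⊔ C) := by rwa [hsup']
  have : Module.Projective Rᵐᵒᵖ ↥(I ⊓ C) := by
    rw [hinf']
    infer_instance
  exact Submodule.projective_of_sup_of_inf I C
end

section
/- Let R be a von Neumann regular right semiartinian ring. Then R satisfies the comparability axiom — for all x, y ∈ R, either xR ≲ yR or yR ≲ xR — if and only if the set Prim_R of right primitive ideals of R is totally ordered by inclusion (equivalently, the simple right R-modules form a chain under the natural partial order given by inclusion of annihilators). -/
namespace RegularRing

variable {S : Type u} [Ring S]

/-- `x` is a two-sided multiple of `y`. Over a regular ring this says that the cyclic module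
generated by `x` embeds in the one generated by `y`. -/
def SubEquiv (x y : S) : Prop := ∃ p q, x = p * y * q

/-- Orthogonality of a pair of idempotents. -/
structure Orthogonal (e f : S) : Prop where
  left_idem : e * e = e
  right_idem : f * f = f
  left_right : e * f = 0
  right_left : f * e = 0

lemma SubEquiv.trans {x y z : S} (h : SubEquiv x y) (h' : SubEquiv y z) : SubEquiv x z := by
  obtain ⟨p, q, rfl⟩ := h
  obtain ⟨p', q', rfl⟩ := h'
  exact ⟨p * p', q' * q, by simp only [mul_assoc]⟩

lemma SubEquiv.mem {x y : S} (h : SubEquiv x y) {I : TwoSidedIdeal S} (hy : y ∈ I) : x ∈ I := by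
  obtain ⟨p, q, rfl⟩ := h
  exact I.mul_mem_right _ _ (I.mul_mem_left _ _ hy)

lemma SubEquiv.mul_mul {x y : S} (h : SubEquiv x y) (r s : S) : SubEquiv (r * x * s) y :=
  SubEquiv.trans ⟨r, s, rfl⟩ h

lemma SubEquiv.add {x₁ x₂ f₁ f₂ : S} (hf : Orthogonal f₁ f₂) (h₁ : SubEquiv x₁ f₁)
    (h₂ : SubEquiv x₂ f₂) : SubEquiv (x₁ + x₂) (f₁ + f₂) := by
  obtain ⟨p₁, q₁, rfl⟩ := h₁
  obtain ⟨p₂, q₂, rfl⟩ := h₂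
  have h11 (a : S) : f₁ * (f₁ * a) = f₁ * a := by rw [← mul_assoc, hf.left_idem]
  have h22 (a : S) : f₂ * (f₂ * a) = f₂ * a := by rw [← mul_assoc, hf.right_idem]
  have h12 (a : S) : f₁ * (f₂ * a) = 0 := by rw [← mul_assoc, hf.left_right, zero_mul]
  have h21 (a : S) : f₂ * (f₁ * a) = 0 := by rw [← mul_assoc, hf.right_left, zero_mul]
  exact ⟨p₁ * f₁ + p₂ * f₂, f₁ * q₁ + f₂ * q₂, by
    simp [mul_add, add_mul, mul_assoc, h11, h22, h12, h21]⟩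

lemma orthogonal_sub {f f₁ : S} (hf : f * f = f) (h₁ : f₁ * f₁ = f₁) (h : f * f₁ = f₁)
    (h' : f₁ * f = f₁) : Orthogonal f₁ (f - f₁) where
  left_idem := h₁
  right_idem := by simp [mul_sub, sub_mul, hf, h₁, h, h']
  left_right := by simp [mul_sub, h₁, h']
  right_left := by simp [sub_mul, h₁, h]

section Regular

variable (hreg : ∀ a : S, ∃ x : S, a = a * x * a)
include hreg

lemma exists_reflexive_inverse (x : S) : ∃ z, x * z * x = x ∧ z * x * z = z := by
  obtain ⟨w, hw⟩ := hreg x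
  have h (a : S) : x * (w * (x * a)) = x * a := by
    simpa only [mul_assoc] using (congrArg (· * a) hw).symm
  refine ⟨w * x * w, ?_, ?_⟩
  · simp only [mul_assoc, h]
    simpa only [mul_assoc] using hw.symm
  · simp only [mul_assoc, h]

lemma exists_idempotent (x : S) : ∃ f : S, f * f = f ∧ SubEquiv x f ∧ SubEquiv f x := by
  obtain ⟨z, h, h'⟩ := exists_reflexive_inverse hreg x
  refine ⟨z * x, by rw [← mul_assoc, h'], ⟨x, 1, ?_⟩, ⟨z, 1, by simp⟩⟩
  rw [mul_one, ← mul_assoc, h]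

lemma SubEquiv.exists_split {x f : S} (hf : f * f = f) (h : SubEquiv x f) :
    ∃ f₁ f₂, f = f₁ + f₂ ∧ Orthogonal f₁ f₂ ∧ SubEquiv x f₁ ∧ SubEquiv f₁ x := by
  obtain ⟨p, q, hx⟩ := h
  obtain ⟨z, h, h'⟩ := exists_reflexive_inverse hreg x
  have hff (a : S) : f * (f * a) = f * a := by rw [← mul_assoc, hf]
  have hxa (a : S) : p * (f * (q * a)) = x * a := by rw [hx]; simp only [mul_assoc]
  have hza (a : S) : z * (x * (z * a)) = z * a := by
    simpa only [mul_assoc] using congrArg (· * a) h'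
  refine ⟨f * q * z * p * f, f - f * q * z * p * f, by simp, orthogonal_sub hf ?_ ?_ ?_,
    ⟨p, q, ?_⟩, ⟨f * q * z, z * p * f, ?_⟩⟩
  · simp only [mul_assoc, hff, hxa, hza]
  · simp only [mul_assoc, hff]
  · simp only [mul_assoc, hf]
  · calc x = x * z * x := h.symm
      _ = (p * f * q) * z * (p * f * q) := by rw [← hx]
      _ = _ := by simp only [mul_assoc]
  · simp only [mul_assoc, hza]

lemma exists_peel {I : TwoSidedIdeal S} {a b : S} (ha : a * a = a)
    (h : ∃ u v, u * b * v - a ∈ I) :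
    ∃ c₁ c₂, a = c₁ + c₂ ∧ Orthogonal c₁ c₂ ∧ c₂ ∈ I ∧ SubEquiv c₁ b := by
  obtain ⟨u, v, h⟩ := h
  set c := a * (u * b * v) * a with hc
  have hac : a * c = c := by simp only [hc, ← mul_assoc, ha]
  have hca : c * a = c := by simp only [hc, mul_assoc, ha]
  have hd : c - a ∈ I := by
    have := I.mul_mem_right _ a (I.mul_mem_left a _ h)
    rwa [mul_sub, sub_mul, ha, ha] at this
  obtain ⟨w, hw⟩ := hreg c
  have hcaw (t : S) : c * (a * t) = c * t := by rw [← mul_assoc, hca]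
  have hcw : c * (w * c) = c := by rw [← mul_assoc, ← hw]
  refine ⟨a * w * c, a - a * w * c, by simp, orthogonal_sub ha ?_ ?_ ?_, ?_,
    ⟨a * w * a * u, v * a, ?_⟩⟩
  · simp only [mul_assoc, hcaw, hcw]
  · simp only [← mul_assoc, ha]
  · simp only [mul_assoc, hca]
  · have h2 : a - a * w * c = (c - a) * (w * c) - (c - a) := by
      rw [sub_mul, hcw, mul_assoc]; abel
    rw [h2]
    exact I.sub_mem (I.mul_mem_right _ _ hd) hd
  · simp only [hc, mul_assoc]

/-- Every proper two-sided ideal of a regular ring is an intersection of annihilators of simple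
modules. -/
lemma exists_simple_of_notMem (I : TwoSidedIdeal S) {r : S} (hr : r ∉ I) :
    ∃ (V : Type u) (_ : AddCommGroup V) (_ : Module S V), IsSimpleModule S V ∧
      (∀ i ∈ I, i ∈ Module.annihilator S V) ∧ r ∉ Module.annihilator S V := by
  obtain ⟨z, h, h'⟩ := exists_reflexive_inverse hreg r
  set g := z * r with hg
  have hgg : g * g = g := by rw [hg, ← mul_assoc, h']
  have hgI : g ∉ I := fun hgI => hr <| by
    rw [← h, mul_assoc]; exact I.mul_mem_left _ _ hgI
  have hne : I.asIdeal ⊔ Ideal.span {1 - g} ≠ ⊤ := by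
    intro htop
    have h1 : (1 : S) ∈ I.asIdeal ⊔ Ideal.span {1 - g} := by rw [htop]; trivial
    obtain ⟨i, hi, y, hy, hiy⟩ := Submodule.mem_sup.1 h1
    obtain ⟨s, rfl⟩ := Ideal.mem_span_singleton'.1 hy
    apply hgI
    have : g = i * g := by
      calc g = (i + s * (1 - g)) * g := by rw [hiy, one_mul]
        _ = i * g + s * (g - g * g) := by noncomm_ring
        _ = i * g := by rw [hgg]; simp
    rw [this]
    exact I.mul_mem_right _ _ hi
  obtain ⟨M, hM, hle⟩ := Ideal.exists_le_maximal _ hne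
  refine ⟨S ⧸ M, inferInstance, inferInstance, isSimpleModule_iff_isCoatom.2 hM.out, ?_, ?_⟩
  · intro i hi
    rw [Module.mem_annihilator]
    intro m
    obtain ⟨s, rfl⟩ := Submodule.Quotient.mk_surjective _ m
    rw [← Submodule.Quotient.mk_smul, Submodule.Quotient.mk_eq_zero]
    exact hle (Submodule.mem_sup_left (I.mul_mem_right _ _ hi))
  · intro hrV
    have hgV := Ideal.mul_mem_left _ z hrV
    rw [← hg, Module.mem_annihilator] at hgV
    have hgM := hgV (Submodule.Quotient.mk 1)
    rw [← Submodule.Quotient.mk_smul, Submodule.Quotient.mk_eq_zero, smul_eq_mul, mul_one] at hgM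
    have h1 : 1 - g ∈ M := hle (Submodule.mem_sup_right (Ideal.mem_span_singleton_self _))
    exact hM.ne_top ((Ideal.eq_top_iff_one _).2 (by simpa using M.add_mem h1 hgM))

/-- If the annihilators of simple modules form a chain, then over a regular semiartinian ring a
proper two-sided ideal `I` is itself such an annihilator, and the quotient by `I` has an element
that is a two-sided multiple of every nonzero element. -/
lemma exists_minimal_element
    (hsa : ∀ (M : Type u) [AddCommGroup M] [Module S M], Nontrivial M →
      ∃ N : Submodule S M, IsSimpleModule S ↥N)
    (hch : ∀ (U V : Type u) [AddCommGroup U] [Module S U] [AddCommGroup V] [Module S V],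
      IsSimpleModule S U → IsSimpleModule S V →
      Module.annihilator S U ≤ Module.annihilator S V ∨
        Module.annihilator S V ≤ Module.annihilator S U)
    (I : TwoSidedIdeal S) (hI : (1 : S) ∉ I) :
    (∃ e ∉ I, ∀ b ∉ I, ∃ u v, u * b * v - e ∈ I) ∧
    ∃ (U : Type u) (_ : AddCommGroup U) (_ : Module S U), IsSimpleModule S U ∧
      ∀ r, r ∈ I ↔ r ∈ Module.annihilator S U := by
  have hnt : Nontrivial (S ⧸ I.asIdeal) :=
    Submodule.Quotient.nontrivial_iff.2 fun h => hI ((Ideal.eq_top_iff_one _).1 h)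
  obtain ⟨N, hN⟩ := hsa (S ⧸ I.asIdeal) hnt
  have hNb : N ≠ ⊥ := by
    rintro rfl
    exact not_subsingleton_iff_nontrivial.2
      (IsSimpleModule.nontrivial S (⊥ : Submodule S (S ⧸ I.asIdeal))) inferInstance
  obtain ⟨m, hmN, hm0⟩ := N.ne_bot_iff.1 hNb
  obtain ⟨a, rfl⟩ := Submodule.Quotient.mk_surjective _ m
  obtain ⟨z, h, h'⟩ := exists_reflexive_inverse hreg a
  set e := z * a with he
  have hee : e * e = e := by rw [he, ← mul_assoc, h']
  have haI : a ∉ I := fun h => hm0 ((Submodule.Quotient.mk_eq_zero _).2 h)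
  have heI : e ∉ I := fun heI => haI <| by
    rw [← h, mul_assoc]; exact I.mul_mem_left _ _ heI
  have heN : (Submodule.Quotient.mk e : S ⧸ I.asIdeal) ∈ N := N.smul_mem z hmN
  have hgen (t : S) (ht : t ∉ I) (htN : (Submodule.Quotient.mk t : S ⧸ I.asIdeal) ∈ N)
      (m : S) (hm : (Submodule.Quotient.mk m : S ⧸ I.asIdeal) ∈ N) : ∃ s, s * t - m ∈ I := by
    have hne : (⟨_, htN⟩ : N) ≠ 0 := fun h0 =>
      ht ((Submodule.Quotient.mk_eq_zero _).1 (congrArg Subtype.val h0))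
    obtain ⟨s, hs⟩ := IsSimpleModule.toSpanSingleton_surjective S hne ⟨_, hm⟩
    have hs' := congrArg Subtype.val hs
    exact ⟨s, (Submodule.Quotient.eq _).1 hs'⟩
  have hann (r : S) : r ∈ Module.annihilator S N ↔ ∀ s, r * s * e ∈ I := by
    rw [Module.mem_annihilator]
    constructor
    · intro hr s
      have := congrArg Subtype.val (hr ⟨_, N.smul_mem s heN⟩)
      rw [mul_assoc]
      exact (Submodule.Quotient.mk_eq_zero _).1 this
    · rintro hr ⟨m, hm⟩
      obtain ⟨t, rfl⟩ := Submodule.Quotient.mk_surjective _ m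
      obtain ⟨s, hs⟩ := hgen e heI heN t hm
      apply Subtype.ext
      refine (Submodule.Quotient.mk_eq_zero _).2 ?_
      have := I.sub_mem (hr s) (I.mul_mem_left r _ hs)
      rwa [mul_sub, mul_assoc, sub_sub_cancel] at this
  have hle : ∀ r, r ∈ Module.annihilator S N → r ∈ I := by
    intro r hr
    by_contra hrI
    obtain ⟨V, _, _, hV, hIV, hrV⟩ := exists_simple_of_notMem hreg I hrI
    by_cases heV : e ∈ Module.annihilator S V
    · rcases hch N V hN hV with hc | hc
      · exact hrV (hc hr)
      · have := (hann e).1 (hc heV) 1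
        rw [mul_one, hee] at this
        exact heI this
    · apply hrV
      rw [Module.mem_annihilator] at heV ⊢
      push Not at heV
      obtain ⟨v, hv⟩ := heV
      intro w
      obtain ⟨s, rfl⟩ := IsSimpleModule.toSpanSingleton_surjective S hv w
      have := Module.mem_annihilator.1 (hIV _ ((hann r).1 hr s)) v
      simpa [mul_smul] using this
  refine ⟨⟨e, heI, fun b hb => ?_⟩, N, inferInstance, inferInstance, hN,
    fun r => ⟨fun hr => ?_, hle r⟩⟩
  · have : ∃ s, b * s * e ∉ I := by
      by_contra! hcon
      exact hb (hle b ((hann b).2 hcon))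
    obtain ⟨s, hs⟩ := this
    obtain ⟨t, ht⟩ := hgen _ hs (N.smul_mem (b * s) heN) e heN
    exact ⟨t, s * e, by simpa only [mul_assoc] using ht⟩
  · exact (hann r).2 fun s => I.mul_mem_right _ _ (I.mul_mem_right _ _ hr)

section Chain

variable (htot : ∀ I J : TwoSidedIdeal S, I ≤ J ∨ J ≤ I)
  (hmin : ∀ I : TwoSidedIdeal S, (1 : S) ∉ I →
    ∃ e ∉ I, ∀ b ∉ I, ∃ u v, u * b * v - e ∈ I)
include hmin

/-- An element of a two-sided ideal `J` is a two-sided multiple of every element outside `J`. -/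
lemma subEquiv_of_notMem (J : TwoSidedIdeal S) {x y : S} (hx : x ∈ J) (hy : y ∉ J) :
    SubEquiv x y := by
  let K : TwoSidedIdeal S := .mk' {x | x ∈ J ∧ ∀ y ∉ J, SubEquiv x y}
    ⟨J.zero_mem, fun y _ => ⟨0, 0, by simp⟩⟩
    (by
      rintro a b ⟨ha, ha'⟩ ⟨hb, hb'⟩
      refine ⟨J.add_mem ha hb, fun y hy => ?_⟩
      obtain ⟨f, hf, hyf, hfy⟩ := exists_idempotent hreg y
      have hfJ : f ∉ J := fun h => hy (hyf.mem h)
      obtain ⟨f₁, f₂, rfl, ho, h₁, h₁'⟩ := (ha' f hfJ).exists_split hreg hf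
      have hf₂ : f₂ ∉ J := fun h => hfJ (J.add_mem (h₁'.mem ha) h)
      exact (SubEquiv.add ho h₁ (hb' f₂ hf₂)).trans hfy)
    (by
      rintro a ⟨ha, ha'⟩
      exact ⟨J.neg_mem ha, fun y hy => by simpa using (ha' y hy).mul_mul (-1) 1⟩)
    (by
      rintro r a ⟨ha, ha'⟩
      exact ⟨J.mul_mem_left _ _ ha, fun y hy => by simpa using (ha' y hy).mul_mul r 1⟩)
    (by
      rintro a r ⟨ha, ha'⟩
      exact ⟨J.mul_mem_right _ _ ha, fun y hy => by simpa using (ha' y hy).mul_mul 1 r⟩)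
  have hK (x : S) : x ∈ K ↔ x ∈ J ∧ ∀ y ∉ J, SubEquiv x y := TwoSidedIdeal.mem_mk' _ _ _ _ _ _ _
  suffices x ∈ K from ((hK x).1 this).2 y hy
  by_contra hxK
  have h1 : (1 : S) ∉ K := fun h => hxK (by simpa using K.mul_mem_left x _ h)
  obtain ⟨e, heK, he⟩ := hmin K h1
  have heJ : e ∈ J := by
    obtain ⟨u, v, huv⟩ := he x hxK
    have := J.sub_mem (J.mul_mem_right _ v (J.mul_mem_left u _ hx)) ((hK _).1 huv).1
    rwa [sub_sub_cancel] at this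
  refine heK ((hK e).2 ⟨heJ, fun y hy => ?_⟩)
  obtain ⟨a, ha, hea, hae⟩ := exists_idempotent hreg e
  have hpeel : ∃ u v, u * y * v - a ∈ K := by
    obtain ⟨u, v, huv⟩ := he y fun h => hy ((hK y).1 h).1
    obtain ⟨p, q, hpq⟩ := hae
    refine ⟨p * u, v * q, ?_⟩
    have := K.mul_mem_right _ q (K.mul_mem_left p _ huv)
    rwa [mul_sub, sub_mul, ← hpq, show p * (u * y * v) * q = p * u * y * (v * q) by
      simp only [mul_assoc]] at this
  obtain ⟨c₁, c₂, rfl, -, hc₂, hc₁⟩ := exists_peel hreg ha hpeel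
  obtain ⟨f, hf, hyf, hfy⟩ := exists_idempotent hreg y
  obtain ⟨f₁, f₂, rfl, ho, h₁, h₁'⟩ := (hc₁.trans hyf).exists_split hreg hf
  have hc₁J : c₁ ∈ J := by
    simpa using J.sub_mem (hae.mem heJ) ((hK _).1 hc₂).1
  have hf₂ : f₂ ∉ J := fun h => hy (hyf.mem (J.add_mem (h₁'.mem hc₁J) h))
  exact hea.trans ((SubEquiv.add ho h₁ (((hK _).1 hc₂).2 f₂ hf₂)).trans hfy)

omit hmin in
/-- Comparability of all two-sided multiples with the elements of `J` passes to sums. -/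
lemma comparable_add (J : TwoSidedIdeal S) {x y : S}
    (hx : ∀ r s, ∀ b ∈ J, SubEquiv (r * x * s) b ∨ SubEquiv b (r * x * s))
    (hy : ∀ r s, ∀ b ∈ J, SubEquiv (r * y * s) b ∨ SubEquiv b (r * y * s))
    (b : S) (hb : b ∈ J) : SubEquiv (x + y) b ∨ SubEquiv b (x + y) := by
  obtain ⟨z, h, h'⟩ := exists_reflexive_inverse hreg (x + y)
  set a := z * (x + y) with ha
  have haa : a * a = a := by rw [ha, ← mul_assoc, h']
  have hxa : SubEquiv (x + y) a := ⟨x + y, 1, by rw [mul_one, ha, ← mul_assoc, h]⟩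
  have hax : SubEquiv a (x + y) := ⟨z, 1, by rw [mul_one]⟩
  obtain ⟨w, hw⟩ := hreg (a * (z * y))
  set g := a * (z * y) with hg
  have hag : a * g = g := by rw [hg, ← mul_assoc, haa]
  have haga (t : S) : a * (g * t) = g * t := by rw [← mul_assoc, hag]
  have hgw (t : S) : g * (w * (g * t)) = g * t := by
    simpa only [mul_assoc] using (congrArg (· * t) hw).symm
  have ho : Orthogonal (g * w * a) (a - g * w * a) := by
    apply orthogonal_sub haa
    · simp only [mul_assoc, haga, hgw]
    · simp only [mul_assoc, haga]
    · simp only [mul_assoc, haa]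
  have ha₁ : a - g * w * a = (a - g * w * a) * z * x * 1 := by
    have h1 : (a - g * w * a) * a = a - g * w * a := by rw [sub_mul, haa, mul_assoc, haa]
    have h2 : (a - g * w * a) * (z * y) = 0 := by
      rw [sub_mul, mul_assoc (g * w), ← hg, ← hw, sub_self]
    calc a - g * w * a = (a - g * w * a) * (z * x + z * y) := by rw [← mul_add, ← ha, h1]
      _ = _ := by rw [mul_add, h2, add_zero, mul_one, mul_assoc _ z x]
  have ha₂ : g * w * a = (a * z) * y * (w * a) := by simp only [hg, mul_assoc]
  have hsum : a = g * w * a + (a - g * w * a) := by simp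
  obtain ⟨f, hf, hbf, hfb⟩ := exists_idempotent hreg b
  have hfJ := hfb.mem hb
  suffices SubEquiv a f ∨ SubEquiv f a from
    this.imp (fun h => hxa.trans (h.trans hfb)) fun h => hbf.trans (h.trans hax)
  generalize g * w * a = a₂ at *
  generalize a - a₂ = a₁ at *
  have c₂ : ∀ b ∈ J, SubEquiv a₂ b ∨ SubEquiv b a₂ := by rw [ha₂]; exact hy _ _
  have c₁ : ∀ b ∈ J, SubEquiv a₁ b ∨ SubEquiv b a₁ := by rw [ha₁]; exact hx _ _
  rw [hsum]
  rcases c₂ f hfJ with h | h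
  · obtain ⟨f₁, f₂, rfl, ho', h₁, h₁'⟩ := h.exists_split hreg hf
    have hf₂ : f₂ ∈ J := by
      have := J.mul_mem_left f₂ _ hfJ
      rwa [mul_add, ho'.right_left, ho'.right_idem, zero_add] at this
    exact (c₁ f₂ hf₂).imp (SubEquiv.add ho' h₁) (SubEquiv.add ho h₁')
  · refine Or.inr (h.trans ⟨a₂, 1, ?_⟩)
    rw [mul_one, mul_add, ho.left_idem, ho.left_right, add_zero]

include htot in
lemma comparable (a b : S) : SubEquiv a b ∨ SubEquiv b a := by
  have hself (x : S) : x ∈ TwoSidedIdeal.span {x} := TwoSidedIdeal.subset_span rfl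
  have hspan {x : S} {I : TwoSidedIdeal S} (h : x ∈ I) : TwoSidedIdeal.span {x} ≤ I :=
    TwoSidedIdeal.span_le.2 (by simpa using h)
  let K : TwoSidedIdeal S := .mk'
    {x | ∀ a ∈ TwoSidedIdeal.span {x}, ∀ b ∈ TwoSidedIdeal.span {x}, SubEquiv a b ∨ SubEquiv b a}
    (by
      intro a ha b hb
      have := hspan (TwoSidedIdeal.zero_mem ⊥) ha
      rw [TwoSidedIdeal.mem_bot] at this
      exact Or.inl ⟨0, 0, by simp [this]⟩)
    (by
      intro x y hx hy a ha b hb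
      rcases htot (.span {x}) (.span {y}) with h | h
      · have hle := hspan (add_mem (h (hself x)) (hself y))
        exact hy a (hle ha) b (hle hb)
      · have hle := hspan (add_mem (hself x) (h (hself y)))
        exact hx a (hle ha) b (hle hb))
    (by
      intro x hx a ha b hb
      have hle := hspan (neg_mem (hself x))
      exact hx a (hle ha) b (hle hb))
    (by
      intro r x hx a ha b hb
      have hle := hspan (TwoSidedIdeal.mul_mem_left _ r _ (hself x))
      exact hx a (hle ha) b (hle hb))
    (by
      intro x r hx a ha b hb
      have hle := hspan (TwoSidedIdeal.mul_mem_right _ _ r (hself x))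
      exact hx a (hle ha) b (hle hb))
  have hK (x : S) : x ∈ K ↔ ∀ a ∈ TwoSidedIdeal.span {x}, ∀ b ∈ TwoSidedIdeal.span {x},
      SubEquiv a b ∨ SubEquiv b a := TwoSidedIdeal.mem_mk' _ _ _ _ _ _ _
  have hKK (a : S) (ha : a ∈ K) (b : S) (hb : b ∈ K) : SubEquiv a b ∨ SubEquiv b a := by
    rcases htot (.span {a}) (.span {b}) with h | h
    · exact (hK b).1 hb a (h (hself a)) b (hself b)
    · exact (hK a).1 ha a (hself a) b (h (hself b))
  by_cases h1 : (1 : S) ∈ K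
  · exact hKK a (by simpa using K.mul_mem_left a _ h1) b (by simpa using K.mul_mem_left b _ h1)
  exfalso
  obtain ⟨e, heK, he⟩ := hmin K h1
  set J := TwoSidedIdeal.span {e}
  let C : TwoSidedIdeal S := .mk'
    {x | ∀ r s, ∀ b ∈ J, SubEquiv (r * x * s) b ∨ SubEquiv b (r * x * s)}
    (fun r s b _ => Or.inl ⟨0, 0, by simp⟩)
    (by
      intro x y hx hy r s b hb
      rw [mul_add, add_mul]
      refine comparable_add hreg J (fun r' s' b hb => ?_) (fun r' s' b hb => ?_) b hb
      · simpa only [mul_assoc] using hx (r' * r) (s * s') b hb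
      · simpa only [mul_assoc] using hy (r' * r) (s * s') b hb)
    (by
      intro x hx r s b hb
      simpa using hx (-r) s b hb)
    (by
      intro t x hx r s b hb
      simpa only [mul_assoc] using hx (r * t) s b hb)
    (by
      intro x t hx r s b hb
      simpa only [mul_assoc] using hx r (t * s) b hb)
  have hC (x : S) : x ∈ C ↔ ∀ r s, ∀ b ∈ J, SubEquiv (r * x * s) b ∨ SubEquiv b (r * x * s) :=
    TwoSidedIdeal.mem_mk' _ _ _ _ _ _ _
  suffices heC : e ∈ C by
    refine heK ((hK e).2 fun a ha b hb => ?_)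
    simpa using (hC a).1 (hspan heC ha) 1 1 b hb
  refine (hC e).2 fun r s b hb => ?_
  obtain ⟨a, ha, hra, har⟩ := exists_idempotent hreg (r * e * s)
  obtain ⟨f, hf, hbf, hfb⟩ := exists_idempotent hreg b
  suffices SubEquiv a f ∨ SubEquiv f a from
    this.imp (fun h => hra.trans (h.trans hfb)) fun h => hbf.trans (h.trans har)
  by_cases hfK : f ∈ K
  · by_cases haK : a ∈ K
    · exact hKK a haK f hfK
    · exact Or.inr (subEquiv_of_notMem hreg hmin K hfK haK)
  have hpeel : ∃ u v, u * f * v - a ∈ K := by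
    obtain ⟨u, v, huv⟩ := he f hfK
    obtain ⟨p, q, hpq⟩ := har.trans ⟨r, s, rfl⟩
    refine ⟨p * u, v * q, ?_⟩
    have := K.mul_mem_right _ q (K.mul_mem_left p _ huv)
    rwa [mul_sub, sub_mul, ← hpq, show p * (u * f * v) * q = p * u * f * (v * q) by
      simp only [mul_assoc]] at this
  obtain ⟨c₁, c₂, rfl, hoc, hc₂, hc₁⟩ := exists_peel hreg ha hpeel
  obtain ⟨f₁, f₂, rfl, ho, h₁, h₁'⟩ := hc₁.exists_split hreg hf
  by_cases hf₂ : f₂ ∈ K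
  · exact (hKK c₂ hc₂ f₂ hf₂).imp (SubEquiv.add ho h₁) (SubEquiv.add hoc h₁')
  · exact Or.inl (SubEquiv.add ho h₁ (subEquiv_of_notMem hreg hmin K hc₂ hf₂))

end Chain

lemma exists_injective_iff_subEquiv (x y : S) :
    (∃ f : ↥(Ideal.span {x}) →ₗ[S] ↥(Ideal.span {y}), Function.Injective f) ↔ SubEquiv x y := by
  constructor
  · rintro ⟨f, hf⟩
    let x' : ↥(Ideal.span {x}) := ⟨x, Ideal.mem_span_singleton_self x⟩
    obtain ⟨p, hp⟩ := Ideal.mem_span_singleton'.1 (f x').2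
    obtain ⟨w, hw⟩ := hreg (f x').1
    have : ((f x').1 * w) • x' = x' := by
      apply hf
      rw [map_smul]
      exact Subtype.ext hw.symm
    refine ⟨p, w * x, ?_⟩
    have h2 : (f x').1 * w * x = x := congrArg Subtype.val this
    rw [hp, ← mul_assoc, h2]
  · rintro ⟨p, q, hpq⟩
    obtain ⟨z, hz⟩ := hreg x
    let φ : S →ₗ[S] S := LinearMap.toSpanSingleton S S (z * p * y)
    refine ⟨φ.restrict fun a _ => Ideal.mem_span_singleton'.2 ⟨a * z * p, ?_⟩, ?_⟩
    · simp [φ, mul_assoc]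
    · have key (a : S) (ha : a ∈ Ideal.span {x}) : φ a * q = a := by
        obtain ⟨t, rfl⟩ := Ideal.mem_span_singleton'.1 ha
        calc t * x * (z * p * y) * q = t * (x * z * (p * y * q)) := by simp only [mul_assoc]
          _ = t * x := by rw [← hpq, ← hz]
      rintro ⟨a, ha⟩ ⟨b, hb⟩ hab
      apply Subtype.ext
      have hab' : φ a = φ b := congrArg Subtype.val hab
      change a = b
      rw [← key a ha, ← key b hb, hab']

end Regular

end RegularRing


open MulOpposite

universe u

/-- The set of right primitive ideals of `R`: annihilators of simple right `R`-modules,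
viewed as left ideals of `Rᵐᵒᵖ`. -/
def primIdeals (R : Type u) [Ring R] : Set (Ideal Rᵐᵒᵖ) :=
  {P | ∃ (U : Type u) (_ : AddCommGroup U) (_ : Module Rᵐᵒᵖ U),
    IsSimpleModule Rᵐᵒᵖ U ∧ P = Module.annihilator Rᵐᵒᵖ U}

/-- `A ≲ B` for right ideals: `A` is isomorphic, as a right `R`-module, to a submodule of
`B`, i.e. there is an injective `Rᵐᵒᵖ`-linear map `A →ₗ B`. -/
def RightIdealSubiso (R : Type u) [Ring R] (A B : Ideal Rᵐᵒᵖ) : Prop :=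
  ∃ f : ↥A →ₗ[Rᵐᵒᵖ] ↥B, Function.Injective f

/-- a von Neumann regular right semiartinian ring satisfies the comparability
axiom (for all `x y`, `xR ≲ yR` or `yR ≲ xR`) iff its right primitive ideals are totally
ordered by inclusion. -/
theorem comparability_iff_prim_isChain
    {R : Type u} [Ring R]
    (hreg : ∀ a : R, ∃ x : R, a = a * x * a)
    (hsa : RightSemiartinian R) :
    (∀ x y : R, RightIdealSubiso R (Ideal.span {op x}) (Ideal.span {op y}) ∨
      RightIdealSubiso R (Ideal.span {op y}) (Ideal.span {op x})) ↔
    IsChain (· ≤ ·) (primIdeals R) := by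
  have hreg' : ∀ a : Rᵐᵒᵖ, ∃ x : Rᵐᵒᵖ, a = a * x * a := fun a => by
    obtain ⟨x, hx⟩ := hreg a.unop
    exact ⟨op x, unop_injective (by simpa [mul_assoc] using hx)⟩
  have hcomp : (∀ x y : R, RightIdealSubiso R (Ideal.span {op x}) (Ideal.span {op y}) ∨
      RightIdealSubiso R (Ideal.span {op y}) (Ideal.span {op x})) ↔
      ∀ a b : Rᵐᵒᵖ, RegularRing.SubEquiv a b ∨ RegularRing.SubEquiv b a := by
    simp only [RightIdealSubiso, RegularRing.exists_injective_iff_subEquiv hreg']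
    exact ⟨fun h a b => h a.unop b.unop, fun h x y => h (op x) (op y)⟩
  rw [hcomp]
  constructor
  · rintro h _ ⟨U, _, _, hU, rfl⟩ _ ⟨V, _, _, hV, rfl⟩ -
    have key {a b : Rᵐᵒᵖ} (W : Type u) [AddCommGroup W] [Module Rᵐᵒᵖ W]
        (hab : RegularRing.SubEquiv a b) (hb : b ∈ Module.annihilator Rᵐᵒᵖ W) :
        a ∈ Module.annihilator Rᵐᵒᵖ W := by
      obtain ⟨p, q, rfl⟩ := hab
      rw [Module.mem_annihilator] at hb ⊢
      intro m
      rw [mul_smul, mul_smul, hb, smul_zero]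
    by_contra! hcon
    obtain ⟨a, haU, haV⟩ := SetLike.not_le_iff_exists.1 hcon.1
    obtain ⟨b, hbV, hbU⟩ := SetLike.not_le_iff_exists.1 hcon.2
    rcases h a b with hab | hab
    · exact haV (key V hab hbV)
    · exact hbU (key U hab haU)
  · intro h
    have hmin := RegularRing.exists_minimal_element hreg' hsa fun U V _ _ _ _ hU hV =>
      h.total ⟨U, _, _, hU, rfl⟩ ⟨V, _, _, hV, rfl⟩
    have htot (I J : TwoSidedIdeal Rᵐᵒᵖ) : I ≤ J ∨ J ≤ I := by
      by_cases hI : (1 : Rᵐᵒᵖ) ∈ I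
      · exact Or.inr fun x _ => by simpa using I.mul_mem_left x _ hI
      by_cases hJ : (1 : Rᵐᵒᵖ) ∈ J
      · exact Or.inl fun x _ => by simpa using J.mul_mem_left x _ hJ
      obtain ⟨U, _, _, hU, hIU⟩ := (hmin I hI).2
      obtain ⟨V, _, _, hV, hJV⟩ := (hmin J hJ).2
      exact (h.total ⟨U, _, _, hU, rfl⟩ ⟨V, _, _, hV, rfl⟩).imp
        (fun hle x hx => (hJV x).2 (hle ((hIU x).1 hx)))
        (fun hle x hx => (hIU x).2 (hle ((hJV x).1 hx)))
    exact RegularRing.comparable hreg' htot fun I hI => (hmin I hI).1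
end

section
/- Let R be a von Neumann regular right semiartinian ring such that R/P is a right artinian ring for every right primitive ideal P of R. Then R is very well behaved if and only if R is a semisimple ring. -/
open MulOpposite

universe u

/-- `R` is very well behaved if every upper subset `𝒮` of the poset of right primitive ideals
equals the set of right primitive ideals containing `⋂ 𝒮` (with `⋂ ∅ = R`). -/
def VeryWellBehaved (R : Type u) [Ring R] : Prop :=
  ∀ 𝒮 : Set (Ideal Rᵐᵒᵖ), 𝒮 ⊆ primIdeals R →
    (∀ P ∈ 𝒮, ∀ Q ∈ primIdeals R, P ≤ Q → Q ∈ 𝒮) →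
    𝒮 = {Q | Q ∈ primIdeals R ∧ sInf 𝒮 ≤ Q}

/-- Primeness of the annihilator of a simple module. -/
theorem IsSimpleModule.le_annihilator_or_le_annihilator {A U : Type*} [Ring A] [AddCommGroup U]
    [Module A U] [IsSimpleModule A U] {I J : Ideal A} [I.IsTwoSided]
    (h : I ⊓ J ≤ Module.annihilator A U) :
    I ≤ Module.annihilator A U ∨ J ≤ Module.annihilator A U := by
  by_contra! hc
  obtain ⟨⟨i, hi, hiU⟩, j, hj, hjU⟩ := And.imp SetLike.not_le_iff_exists.mp
    SetLike.not_le_iff_exists.mp hc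
  simp only [Module.mem_annihilator, not_forall] at hiU hjU
  obtain ⟨u, hu⟩ := hiU
  obtain ⟨v, hv⟩ := hjU
  obtain ⟨a, ha⟩ := IsSimpleModule.toSpanSingleton_surjective A hv u
  rw [LinearMap.toSpanSingleton_apply] at ha
  have hmem : i * (a * j) ∈ I ⊓ J :=
    ⟨I.mul_mem_right _ hi, J.mul_mem_left _ (J.mul_mem_left _ hj)⟩
  have hzero := Module.mem_annihilator.mp (h hmem) v
  rw [mul_smul, mul_smul, ha] at hzero
  exact hu hzero

theorem IsSimpleModule.annihilator_ne_top {A U : Type*} [Ring A] [AddCommGroup U]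
    [Module A U] [IsSimpleModule A U] : Module.annihilator A U ≠ ⊤ := by
  intro h
  have := IsSimpleModule.nontrivial A U
  obtain ⟨u, hu⟩ := exists_ne (0 : U)
  have h1 : (1 : A) ∈ Module.annihilator A U := h ▸ Submodule.mem_top
  exact hu (by simpa using Module.mem_annihilator.mp h1 u)

theorem IsSimpleModule.map_subtype {A M : Type*} [Ring A] [AddCommGroup M] [Module A M]
    {N : Submodule A M} {T : Submodule A N} (hT : IsSimpleModule A T) :
    IsSimpleModule A (T.map N.subtype) :=
  IsSimpleModule.congr (N.equivSubtypeMap T).symm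

/-- A finite intersection of two-sided ideals inside the annihilator of a simple module
has one of its members there. -/
theorem IsSimpleModule.exists_le_annihilator_of_finset_inf_le {A U : Type*} [Ring A]
    [AddCommGroup U] [Module A U] [IsSimpleModule A U] (s : Finset (Ideal A))
    (hs : ∀ P ∈ s, P.IsTwoSided) (h : s.inf id ≤ Module.annihilator A U) :
    ∃ P ∈ s, P ≤ Module.annihilator A U := by
  classical
  induction s using Finset.induction_on with
  | empty => exact absurd (top_le_iff.mp (by simpa using h)) IsSimpleModule.annihilator_ne_top
  | insert P s _ ih =>
    have := hs P (Finset.mem_insert_self P s)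
    rw [Finset.inf_insert, id] at h
    rcases IsSimpleModule.le_annihilator_or_le_annihilator h with hP | hP
    · exact ⟨P, Finset.mem_insert_self P s, hP⟩
    · obtain ⟨Q, hQ, hQU⟩ := ih (fun P hP => hs P (Finset.mem_insert_of_mem hP)) hP
      exact ⟨Q, Finset.mem_insert_of_mem hQ, hQU⟩

/-- The factor ring by the annihilator of a simple module is semisimple if it is artinian. -/
theorem IsSimpleModule.isSemisimpleModule_quotient_annihilator {A U : Type*} [Ring A]
    [AddCommGroup U] [Module A U] [IsSimpleModule A U]
    [IsArtinian A (A ⧸ Module.annihilator A U)] :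
    IsSemisimpleModule A (A ⧸ Module.annihilator A U) := by
  rw [IsArtinian.isSemisimpleModule_iff_jacobson, eq_bot_iff]
  intro x hx
  obtain ⟨a, rfl⟩ := Submodule.mkQ_surjective _ x
  rw [Submodule.mem_bot, Submodule.mkQ_apply, Submodule.Quotient.mk_eq_zero,
    Module.mem_annihilator]
  intro u
  have hle : Module.annihilator A U ≤ LinearMap.ker (LinearMap.toSpanSingleton A U u) :=
    fun b hb => Module.mem_annihilator.mp hb u
  have hmem := Module.le_comap_jacobson
    ((Module.annihilator A U).liftQ (LinearMap.toSpanSingleton A U u) hle) hx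
  rw [IsSimpleModule.jacobson_eq_bot] at hmem
  exact hmem

/-- The annihilator of a simple module is a maximal two-sided ideal if its factor ring
is artinian. -/
theorem IsSimpleModule.le_annihilator_of_annihilator_le {A U : Type*} [Ring A]
    [AddCommGroup U] [Module A U] [IsSimpleModule A U]
    [IsArtinian A (A ⧸ Module.annihilator A U)] {Q : Ideal A} [Q.IsTwoSided] (hQ : Q ≠ ⊤)
    (h : Module.annihilator A U ≤ Q) : Q ≤ Module.annihilator A U := by
  have := IsSimpleModule.isSemisimpleModule_quotient_annihilator (A := A) (U := U)
  set P := Module.annihilator A U with hP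
  obtain ⟨C, hC⟩ := exists_isCompl (Submodule.map P.mkQ Q)
  have hQmap : Submodule.comap P.mkQ (Submodule.map P.mkQ Q) = Q := by
    rw [Submodule.comap_map_mkQ, sup_eq_right.mpr h]
  have hinf : Q ⊓ Submodule.comap P.mkQ C ≤ P := by
    conv_lhs => rw [← hQmap]
    rw [← Submodule.comap_inf, hC.inf_eq_bot, ← LinearMap.ker, Submodule.ker_mkQ]
  rcases IsSimpleModule.le_annihilator_or_le_annihilator hinf with hl | hl
  · exact hl
  · have hbot : C = ⊥ := by
      rw [← Submodule.map_comap_eq_of_surjective P.mkQ_surjective C, eq_bot_iff,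
        Submodule.map_le_iff_le_comap, ← LinearMap.ker, Submodule.ker_mkQ]
      exact hl
    have htop := hC.sup_eq_top
    rw [hbot, sup_bot_eq] at htop
    rw [htop, Submodule.comap_top] at hQmap
    exact absurd hQmap.symm hQ

/-- A ring is semisimple unless some simple module is annihilated by all minimal left ideals. -/
theorem IsSemisimpleRing.of_forall_exists_not_le_annihilator {A : Type*} [Ring A]
    (h : ∀ M : Ideal A, M.IsMaximal →
      ∃ T : Ideal A, IsSimpleModule A T ∧ ¬ T ≤ Module.annihilator A (A ⧸ M)) :
    IsSemisimpleRing A := by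
  refine isSemisimpleModule_of_isSemisimpleModule_submodule' (p := fun
    T : {T : Ideal A // IsSimpleModule A T} => T.1) (fun T => ?_) ?_
  · have := T.2
    infer_instance
  · by_contra hne
    obtain ⟨M, hM, hle⟩ := Ideal.exists_le_maximal _ hne
    obtain ⟨T, hT, hTM⟩ := h M hM
    refine hTM fun t ht => Module.mem_annihilator.mpr fun x => ?_
    obtain ⟨a, rfl⟩ := Submodule.mkQ_surjective _ x
    rw [Submodule.mkQ_apply, ← Submodule.Quotient.mk_smul, Submodule.Quotient.mk_eq_zero]
    let f : T →ₗ[A] A := LinearMap.toSpanSingleton A A a ∘ₗ T.subtype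
    rcases LinearMap.injective_or_eq_zero f with hf | hf
    · have hrange : IsSimpleModule A (LinearMap.range f) :=
        IsSimpleModule.congr (LinearEquiv.ofInjective f hf).symm
      exact hle (le_iSup (fun T : {T : Ideal A // IsSimpleModule A T} => T.1)
        ⟨LinearMap.range f, hrange⟩ ⟨⟨t, ht⟩, rfl⟩)
    · have : t • a = 0 := LinearMap.congr_fun hf ⟨t, ht⟩
      rw [this]
      exact M.zero_mem

theorem isTwoSided_of_mem_primIdeals {R : Type u} [Ring R] {P : Ideal Rᵐᵒᵖ}
    (hP : P ∈ primIdeals R) : P.IsTwoSided := by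
  obtain ⟨U, _, _, _, rfl⟩ := hP
  infer_instance

theorem VeryWellBehaved.of_isArtinianRing {R : Type u} [Ring R] [IsArtinianRing Rᵐᵒᵖ] :
    VeryWellBehaved R := by
  intro S hS hup
  refine Set.Subset.antisymm (fun Q hQ => ⟨hS hQ, sInf_le hQ⟩) ?_
  rintro Q ⟨hQ, hle⟩
  classical
  obtain ⟨s, hs⟩ := Finset.exists_inf_le (Subtype.val : S → Ideal Rᵐᵒᵖ)
  have hinf : (s.image Subtype.val).inf id ≤ Q := by
    rw [Finset.inf_image, Function.id_comp]
    exact (le_sInf fun P hP => hs ⟨P, hP⟩).trans hle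
  have hmem : ∀ P ∈ s.image Subtype.val, P ∈ S := by simp +contextual
  obtain ⟨U, _, _, _, hU⟩ := id hQ
  obtain ⟨P, hP, hPQ⟩ := IsSimpleModule.exists_le_annihilator_of_finset_inf_le (U := U) _
    (fun P hP => isTwoSided_of_mem_primIdeals (hS (hmem P hP))) (hU ▸ hinf)
  exact hup P (hmem P hP) Q hQ (hU ▸ hPQ)

theorem VeryWellBehaved.isSemisimpleRing {R : Type u} [Ring R]
    (hreg : ∀ a : R, ∃ x : R, a = a * x * a) (hsa : RightSemiartinian R)
    (hart : ∀ P ∈ primIdeals R, IsArtinian Rᵐᵒᵖ (Rᵐᵒᵖ ⧸ P)) (h : VeryWellBehaved R) :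
    IsSemisimpleRing Rᵐᵒᵖ := by
  refine .of_forall_exists_not_le_annihilator fun M hM => ?_
  have hsimple : IsSimpleModule Rᵐᵒᵖ (Rᵐᵒᵖ ⧸ M) := isSimpleModule_iff_isCoatom.mpr hM.out
  have hprim : Module.annihilator Rᵐᵒᵖ (Rᵐᵒᵖ ⧸ M) ∈ primIdeals R :=
    ⟨_, _, _, hsimple, rfl⟩
  let S : Set (Ideal Rᵐᵒᵖ) :=
    {P | P ∈ primIdeals R ∧ ∃ T : Ideal Rᵐᵒᵖ, IsSimpleModule Rᵐᵒᵖ T ∧ ¬ T ≤ P}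
  have hup : ∀ P ∈ S, ∀ Q ∈ primIdeals R, P ≤ Q → Q ∈ S := by
    rintro P ⟨hP, T, hT, hTP⟩ Q hQ hPQ
    have := hart P hP
    have := isTwoSided_of_mem_primIdeals hQ
    have hQtop : Q ≠ ⊤ := by
      obtain ⟨V, _, _, _, rfl⟩ := hQ
      exact IsSimpleModule.annihilator_ne_top
    obtain ⟨U, _, _, _, rfl⟩ := hP
    exact ⟨hQ, T, hT, fun hTQ =>
      hTP (hTQ.trans (IsSimpleModule.le_annihilator_of_annihilator_le hQtop hPQ))⟩
  have hbot : sInf S = ⊥ := by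
    by_contra hne
    obtain ⟨N, hN⟩ := hsa (sInf S : Ideal Rᵐᵒᵖ) ((Submodule.nontrivial_iff_ne_bot).mpr hne)
    let T : Ideal Rᵐᵒᵖ := N.map (sInf S : Ideal Rᵐᵒᵖ).subtype
    have hTS : T ≤ sInf S := Submodule.map_subtype_le _ _
    have hT : IsSimpleModule Rᵐᵒᵖ T := hN.map_subtype
    have hTann : ¬ T ≤ Module.annihilator Rᵐᵒᵖ T := by
      intro hle
      have := IsSimpleModule.nontrivial Rᵐᵒᵖ T
      obtain ⟨t, ht⟩ := exists_ne (0 : T)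
      obtain ⟨x, hx⟩ := hreg (unop t.1)
      have hzero := congrArg Subtype.val (Module.mem_annihilator.mp (hle t.2) (op x • t))
      refine ht (Subtype.ext (unop_injective ?_))
      rw [hx]
      simpa [mul_assoc] using congrArg unop hzero
    exact hTann (hTS.trans (sInf_le ⟨⟨T, _, _, hT, rfl⟩, T, hT, hTann⟩))
  have hmem : Module.annihilator Rᵐᵒᵖ (Rᵐᵒᵖ ⧸ M) ∈ S := by
    rw [h S (fun P hP => hP.1) hup]
    exact ⟨hprim, hbot ▸ bot_le⟩
  exact hmem.2

/-- a von Neumann regular right semiartinian ring all of whose primitive factor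
rings are right artinian is very well behaved iff it is semisimple. -/
theorem veryWellBehaved_iff_isSemisimpleRing
    {R : Type u} [Ring R]
    (hreg : ∀ a : R, ∃ x : R, a = a * x * a)
    (hsa : RightSemiartinian R)
    (hart : ∀ P ∈ primIdeals R, IsArtinian Rᵐᵒᵖ (Rᵐᵒᵖ ⧸ P)) :
    VeryWellBehaved R ↔ IsSemisimpleRing R := by
  rw [← isSemisimpleRing_mulOpposite_iff]
  exact ⟨fun h => h.isSemisimpleRing hreg hsa hart, fun _ => .of_isArtinianRing⟩
end

section
/- Let R be a von Neumann regular right semiartinian ring that is very well behaved. Then the set of maximal elements of Prim_R (right primitive ideals maximal among right primitive ideals under inclusion) is finite; equivalently, the poset of simple right R-modules under the natural partial order has only finitely many maximal elements. -/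
open MulOpposite

universe u

theorem mul_mem_of_mem_primIdeals {R : Type u} [Ring R] {P : Ideal Rᵐᵒᵖ}
    (hP : P ∈ primIdeals R) {x : Rᵐᵒᵖ} (hx : x ∈ P) (s : Rᵐᵒᵖ) : x * s ∈ P := by
  obtain ⟨U, _, _, _, rfl⟩ := hP
  rw [Module.mem_annihilator] at hx ⊢
  intro m
  rw [mul_smul, hx]

/-- A two-sided ideal contained in a maximal one-sided ideal is contained in a primitive ideal;
the primitive ideal can be chosen uniformly for all such two-sided ideals. -/
theorem exists_primIdeals_forall_le {R : Type u} [Ring R] {m : Ideal Rᵐᵒᵖ} (hm : m.IsMaximal) :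
    ∃ Q ∈ primIdeals R, ∀ I : Ideal Rᵐᵒᵖ, (∀ x ∈ I, ∀ s, x * s ∈ I) → I ≤ m → I ≤ Q := by
  refine ⟨Module.annihilator Rᵐᵒᵖ (Rᵐᵒᵖ ⧸ m), ⟨Rᵐᵒᵖ ⧸ m, inferInstance, inferInstance,
    isSimpleModule_iff_isCoatom.mpr hm.out, rfl⟩, fun I hI hIm x hx ↦ ?_⟩
  rw [Module.mem_annihilator]
  intro y
  obtain ⟨s, rfl⟩ := Submodule.Quotient.mk_surjective m y
  rw [← Submodule.Quotient.mk_smul, Submodule.Quotient.mk_eq_zero, smul_eq_mul]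
  exact hIm (hI x hx s)

/-- a von Neumann regular right semiartinian very well behaved ring has only
finitely many maximal elements in its poset of right primitive ideals. -/
theorem finite_maximal_primIdeals_of_veryWellBehaved
    {R : Type u} [Ring R]
    (hreg : ∀ a : R, ∃ x : R, a = a * x * a)
    (hsa : RightSemiartinian R)
    (hvwb : VeryWellBehaved R) :
    {P | P ∈ primIdeals R ∧ ∀ Q ∈ primIdeals R, P ≤ Q → Q = P}.Finite := by
  set M : Set (Ideal Rᵐᵒᵖ) := {P | P ∈ primIdeals R ∧ ∀ Q ∈ primIdeals R, P ≤ Q → Q = P}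
  obtain hM | ⟨P₀, hP₀⟩ := M.eq_empty_or_nonempty
  · simp [hM]
  have mem_diff {P Q : Ideal Rᵐᵒᵖ} (hQ : Q ∈ primIdeals R) (h : sInf (M \ {P}) ≤ Q) :
      Q ∈ M \ {P} := by
    rw [hvwb (M \ {P}) (fun _ h ↦ h.1.1) fun A hA B hB hAB ↦ hA.1.2 B hB hAB ▸ hA]
    exact ⟨hQ, h⟩
  have hmul (P : Ideal Rᵐᵒᵖ) : ∀ x ∈ sInf (M \ {P}), ∀ s, x * s ∈ sInf (M \ {P}) := by
    intro x hx s
    rw [Submodule.mem_sInf] at hx ⊢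
    exact fun A hA ↦ mul_mem_of_mem_primIdeals hA.1.1 (hx A hA) s
  have htop : ⨆ P : M, sInf (M \ {P.1}) = ⊤ := by
    by_contra hne
    obtain ⟨m, hm, hle⟩ := Ideal.exists_le_maximal _ hne
    obtain ⟨Q, hQ, hQm⟩ := exists_primIdeals_forall_le hm
    have hmem (P : M) : Q ∈ M \ {P.1} :=
      mem_diff hQ (hQm _ (hmul P) ((le_iSup (fun P : M ↦ sInf (M \ {P.1})) P).trans hle))
    exact (hmem ⟨Q, (hmem ⟨P₀, hP₀⟩).1⟩).2 rfl
  obtain ⟨t, ht⟩ := Submodule.mem_iSup_iff_exists_finset.mp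
    (htop ▸ Submodule.mem_top : (1 : Rᵐᵒᵖ) ∈ ⨆ P : M, sInf (M \ {P.1}))
  refine (t.finite_toSet.image Subtype.val).subset fun P hP ↦ ?_
  by_contra hPt
  have hle : ⨆ A ∈ t, sInf (M \ {A.1}) ≤ P :=
    iSup₂_le fun A hA ↦ sInf_le ⟨hP, fun h ↦ hPt ⟨A, hA, h.symm⟩⟩
  obtain ⟨U, _, _, _, hU⟩ := hP.1
  have := IsSimpleModule.nontrivial Rᵐᵒᵖ U
  obtain ⟨u, hu⟩ := exists_ne (0 : U)
  have h1 : (1 : Rᵐᵒᵖ) ∈ Module.annihilator Rᵐᵒᵖ U := hU ▸ hle ht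
  exact hu (by simpa using Module.mem_annihilator.mp h1 u)
end

section
/- Let R be a von Neumann regular right semiartinian ring. Then the set of minimal elements of Prim_R is finite if and only if the set {ann(U) : U a projective simple right R-module} is finite; and in that case, a right primitive ideal is a minimal element of Prim_R if and only if it is the annihilator of some projective simple right R-module. -/
open MulOpposite

universe u

/-- The set of annihilators of projective simple right `R`-modules. -/
def projSimpleAnnIdeals (R : Type u) [Ring R] : Set (Ideal Rᵐᵒᵖ) :=
  {P | ∃ (U : Type u) (_ : AddCommGroup U) (_ : Module Rᵐᵒᵖ U),
    IsSimpleModule Rᵐᵒᵖ U ∧ Module.Projective Rᵐᵒᵖ U ∧ P = Module.annihilator Rᵐᵒᵖ U}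

/-- If a finite intersection of two-sided ideals annihilates a simple module, then so does one of
the ideals. -/
theorem exists_le_annihilator_of_sInf_le {S V : Type*} [Ring S] [AddCommGroup V] [Module S V]
    [IsSimpleModule S V] {F : Set (Ideal S)} (hF : F.Finite) (htwo : ∀ I ∈ F, I.IsTwoSided)
    (hle : sInf F ≤ Module.annihilator S V) : ∃ I ∈ F, I ≤ Module.annihilator S V := by
  induction F, hF using Set.Finite.induction_on with
  | empty =>
    have := IsSimpleModule.nontrivial S V
    obtain ⟨v, hv⟩ := exists_ne (0 : V)
    rw [sInf_empty] at hle
    have h1 : (1 : S) ∈ Module.annihilator S V := hle Submodule.mem_top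
    exact absurd (by simpa using Module.mem_annihilator.1 h1 v) hv
  | @insert I F _ _ ih =>
    by_cases hI : I ≤ Module.annihilator S V
    · exact ⟨I, Set.mem_insert _ _, hI⟩
    suffices h : sInf F ≤ Module.annihilator S V by
      obtain ⟨J, hJ, hJV⟩ := ih (fun J hJ => htwo J (Set.mem_insert_of_mem _ hJ)) h
      exact ⟨J, Set.mem_insert_of_mem _ hJ, hJV⟩
    have := htwo I (Set.mem_insert _ _)
    obtain ⟨a, ha, haV⟩ := SetLike.not_le_iff_exists.1 hI
    simp only [Module.mem_annihilator, not_forall] at haV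
    obtain ⟨v, hv⟩ := haV
    intro b hb
    rw [Module.mem_annihilator]
    intro w
    by_contra hw
    obtain ⟨s, hs⟩ := IsSimpleModule.toSpanSingleton_surjective S hw v
    have hmem : a * (s * b) ∈ sInf (insert I F) := by
      rw [sInf_insert]
      exact ⟨I.mul_mem_right _ ha, Ideal.mul_mem_left _ _ (Ideal.mul_mem_left _ _ hb)⟩
    have h0 := Module.mem_annihilator.1 (hle hmem) w
    rw [LinearMap.toSpanSingleton_apply] at hs
    rw [mul_smul, mul_smul, hs] at h0
    exact hv h0

/-- The annihilator of a projective simple module is minimal among annihilators of simple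
modules. -/
theorem annihilator_eq_of_le_of_projective {S U V : Type*} [Ring S] [AddCommGroup U] [Module S U]
    [AddCommGroup V] [Module S V] [IsSimpleModule S U] [IsSimpleModule S V] [Module.Projective S U]
    (hle : Module.annihilator S V ≤ Module.annihilator S U) :
    Module.annihilator S V = Module.annihilator S U := by
  have := IsSimpleModule.nontrivial S U
  obtain ⟨u, hu⟩ := exists_ne (0 : U)
  obtain ⟨i, hi⟩ := Module.projective_lifting_property (LinearMap.toSpanSingleton S U u)
    LinearMap.id (IsSimpleModule.toSpanSingleton_surjective S hu)
  have hiu : i u • u = u := LinearMap.congr_fun hi u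
  have hV : i u ∉ Module.annihilator S V := fun h =>
    hu (hiu.symm.trans (Module.mem_annihilator.1 (hle h) u))
  simp only [Module.mem_annihilator, not_forall] at hV
  obtain ⟨v, hv⟩ := hV
  let f : U →ₗ[S] V := (LinearMap.toSpanSingleton S V v).comp i
  have hf : f ≠ 0 := fun h => hv (LinearMap.congr_fun h u)
  exact (LinearEquiv.ofBijective f (LinearMap.bijective_of_ne_zero hf)).annihilator_eq.symm

/-- A simple module embedding into a von Neumann regular ring is projective, and its image does
not annihilate it. -/
theorem projective_of_injective_of_regular {S N : Type*} [Ring S]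
    (hreg : ∀ a : S, ∃ x : S, a = a * x * a) [AddCommGroup N] [Module S N] [IsSimpleModule S N]
    (f : N →ₗ[S] S) (hf : Function.Injective f) :
    Module.Projective S N ∧ ∃ n, f n ∉ Module.annihilator S N := by
  have := IsSimpleModule.nontrivial S N
  obtain ⟨m, hm⟩ := exists_ne (0 : N)
  obtain ⟨x, hx⟩ := hreg (f m)
  have hidem : f (x • m) • (x • m) = x • m := by
    apply hf
    simp only [map_smul, smul_eq_mul]
    rw [mul_assoc, ← mul_assoc (f m), ← hx]
  have hne : x • m ≠ 0 := by
    intro h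
    have h0 : x * f m = 0 := by rw [← smul_eq_mul, ← map_smul, h, map_zero]
    rw [mul_assoc, h0, mul_zero] at hx
    exact hm (hf (hx.trans (map_zero f).symm))
  refine ⟨Module.Projective.of_split f (LinearMap.toSpanSingleton S N (x • m)) ?_, x • m,
    fun h => hne (hidem.symm.trans (Module.mem_annihilator.1 h _))⟩
  ext n
  obtain ⟨s, rfl⟩ := IsSimpleModule.toSpanSingleton_surjective S hne n
  simp only [LinearMap.comp_apply, LinearMap.toSpanSingleton_apply, LinearMap.id_apply]
  rw [map_smul, smul_assoc, hidem]

/-- A simple submodule of a left ideal of a von Neumann regular ring is projective, and the ideal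
does not annihilate it. -/
theorem projective_of_submodule_ideal {S : Type*} [Ring S]
    (hreg : ∀ a : S, ∃ x : S, a = a * x * a) {I : Ideal S} (N : Submodule S I)
    [IsSimpleModule S N] : Module.Projective S N ∧ ¬ I ≤ Module.annihilator S N := by
  obtain ⟨hproj, n, hn⟩ := projective_of_injective_of_regular hreg
    ((Submodule.subtype I).comp N.subtype) (fun _ _ h => Subtype.ext (Subtype.ext h))
  exact ⟨hproj, fun h => hn (h n.1.2)⟩

/-- Over a von Neumann regular right semiartinian ring, no nonzero element annihilates all
projective simple modules. -/
theorem sInf_projSimpleAnnIdeals {R : Type u} [Ring R] (hreg : ∀ a : R, ∃ x : R, a = a * x * a)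
    (hsa : RightSemiartinian R) : sInf (projSimpleAnnIdeals R) = ⊥ := by
  by_contra hne
  obtain ⟨N, hN⟩ := hsa _ (Submodule.nontrivial_iff_ne_bot.2 hne)
  have hreg' : ∀ a : Rᵐᵒᵖ, ∃ x : Rᵐᵒᵖ, a = a * x * a := fun a => by
    obtain ⟨x, hx⟩ := hreg a.unop
    exact ⟨op x, unop_injective (by simpa [mul_assoc] using hx)⟩
  obtain ⟨hproj, hn⟩ := projective_of_submodule_ideal hreg' N
  exact hn (sInf_le ⟨N, _, _, hN, hproj, rfl⟩)

/-- for a von Neumann regular right semiartinian ring, the set of minimal right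
primitive ideals is finite iff the set of annihilators of projective simple right modules is
finite; and in that case a right primitive ideal is minimal iff it is the annihilator of a
projective simple right module. -/
theorem minimal_primIdeals_finite_iff
    {R : Type u} [Ring R]
    (hreg : ∀ a : R, ∃ x : R, a = a * x * a)
    (hsa : RightSemiartinian R) :
    ({P | P ∈ primIdeals R ∧ ∀ Q ∈ primIdeals R, Q ≤ P → Q = P}.Finite ↔
      (projSimpleAnnIdeals R).Finite) ∧
    ({P | P ∈ primIdeals R ∧ ∀ Q ∈ primIdeals R, Q ≤ P → Q = P}.Finite →
      ∀ P ∈ primIdeals R,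
        ((∀ Q ∈ primIdeals R, Q ≤ P → Q = P) ↔ P ∈ projSimpleAnnIdeals R)) := by
  have hmin : ∀ P ∈ projSimpleAnnIdeals R, P ∈ primIdeals R ∧
      ∀ Q ∈ primIdeals R, Q ≤ P → Q = P := by
    rintro _ ⟨U, _, _, hU, hproj, rfl⟩
    refine ⟨⟨U, _, _, hU, rfl⟩, ?_⟩
    rintro _ ⟨V, _, _, hV, rfl⟩ hle
    exact annihilator_eq_of_le_of_projective hle
  have hproj : (projSimpleAnnIdeals R).Finite → ∀ P ∈ primIdeals R,
      (∀ Q ∈ primIdeals R, Q ≤ P → Q = P) → P ∈ projSimpleAnnIdeals R := by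
    rintro hfin _ ⟨V, _, _, hV, rfl⟩ hP
    obtain ⟨Q, hQ, hle⟩ := exists_le_annihilator_of_sInf_le (V := V) hfin
      (by rintro _ ⟨U, _, _, -, -, rfl⟩; infer_instance)
      ((sInf_projSimpleAnnIdeals hreg hsa).trans_le bot_le)
    exact hP Q (hmin Q hQ).1 hle ▸ hQ
  have hfin : {P | P ∈ primIdeals R ∧ ∀ Q ∈ primIdeals R, Q ≤ P → Q = P}.Finite →
      (projSimpleAnnIdeals R).Finite := fun h => h.subset hmin
  exact ⟨⟨hfin, fun h => h.subset fun P hP => hproj h P hP.1 hP.2⟩,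
    fun h P hP => ⟨hproj (hfin h) P hP, fun hA => (hmin P hA).2⟩⟩
end

section
/- Let R be a right semiartinian ring. If U and V are simple right R-modules with ann(U) = ann(V), then U and V are isomorphic as right R-modules. (Consequently the assignment U ↦ ann(U) induces a bijection from the set of isomorphism classes of simple right R-modules onto the set of right primitive ideals of R.) -/
open MulOpposite

universe u

/-- A simple module with annihilator `P` is isomorphic to every simple submodule of `S ⧸ P`. -/
theorem nonempty_linearEquiv_of_isSimpleModule_quotient {S W : Type*} [Ring S] [AddCommGroup W]
    [Module S W] [IsSimpleModule S W] {P : Ideal S} (hP : Module.annihilator S W = P)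
    (N : Submodule S (S ⧸ P)) [IsSimpleModule S N] : Nonempty (N ≃ₗ[S] W) := by
  have := IsSimpleModule.nontrivial S N
  obtain ⟨⟨n, hn⟩, hn0⟩ := exists_ne (0 : N)
  obtain ⟨s, rfl⟩ := Submodule.Quotient.mk_surjective P n
  have hs : s ∉ Module.annihilator S W := fun h => hn0 <| Subtype.ext <|
    (Submodule.Quotient.mk_eq_zero P).2 (hP ▸ h)
  obtain ⟨w, hw⟩ : ∃ w : W, s • w ≠ 0 := by
    simpa [Module.mem_annihilator] using hs
  have hker : P ≤ LinearMap.ker (LinearMap.toSpanSingleton S W w) := fun t ht => by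
    simpa using Module.mem_annihilator.1 (hP.symm ▸ ht) w
  let f : N →ₗ[S] W := (P.liftQ (LinearMap.toSpanSingleton S W w) hker).comp N.subtype
  have hf : f ≠ 0 := fun h => hw <| by
    simpa [f] using LinearMap.congr_fun h ⟨_, hn⟩
  exact ⟨LinearEquiv.ofBijective f (LinearMap.bijective_of_ne_zero hf)⟩

/-- over a right semiartinian ring, two simple right modules with the same
annihilator are isomorphic. -/
theorem simple_iso_of_annihilator_eq
    {R : Type u} [Ring R]
    (hsa : RightSemiartinian R)
    (U V : Type u) [AddCommGroup U] [Module Rᵐᵒᵖ U] [AddCommGroup V] [Module Rᵐᵒᵖ V]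
    (hU : IsSimpleModule Rᵐᵒᵖ U) (hV : IsSimpleModule Rᵐᵒᵖ V)
    (hann : Module.annihilator Rᵐᵒᵖ U = Module.annihilator Rᵐᵒᵖ V) :
    Nonempty (U ≃ₗ[Rᵐᵒᵖ] V) := by
  have := IsSimpleModule.nontrivial Rᵐᵒᵖ U
  have hne : Module.annihilator Rᵐᵒᵖ U ≠ ⊤ := fun h =>
    not_subsingleton U (Module.annihilator_eq_top_iff.1 h)
  obtain ⟨N, hN⟩ := hsa (Rᵐᵒᵖ ⧸ Module.annihilator Rᵐᵒᵖ U)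
    (Submodule.Quotient.nontrivial_iff.2 hne)
  obtain ⟨e⟩ := nonempty_linearEquiv_of_isSimpleModule_quotient rfl N
  obtain ⟨e'⟩ := nonempty_linearEquiv_of_isSimpleModule_quotient hann.symm N
  exact ⟨e.symm.trans e'⟩
end
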